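/- For all n ≥ 0, the number of partitions of 11n+6 is divisible by 11. -/

import Mathlib

open Finset

section GaussBinom

/-- The Gaussian binomial coefficient with parameter `q`, via the `q`-Pascal rule. -/
def gaussBinom {A : Type*} [CommRing A] (q : A) : ℕ → ℕ → A
  | _, 0 => 1
  | 0, _ + 1 => 0
  | n + 1, k + 1 => gaussBinom q n k + q ^ (k + 1) * gaussBinom q n (k + 1)

/-- The finite `q`-Pochhammer product `(1 - q) ⋯ (1 - q ^ n)`. -/
def qPochhammer {A : Type*} [CommRing A] (q : A) (n : ℕ) : A :=
  ∏ i ∈ range n, (1 - q ^ (i + 1))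

variable {A : Type*} [CommRing A] (q : A)

theorem gaussBinom_zero_right (n : ℕ) : gaussBinom q n 0 = 1 := by
  cases n <;> rfl

theorem gaussBinom_succ_succ (n k : ℕ) :
    gaussBinom q (n + 1) (k + 1) = gaussBinom q n k + q ^ (k + 1) * gaussBinom q n (k + 1) :=
  rfl

theorem gaussBinom_of_lt {n k : ℕ} (h : n < k) : gaussBinom q n k = 0 := by
  induction n generalizing k with
  | zero => obtain ⟨k, rfl⟩ := Nat.exists_eq_add_one_of_ne_zero h.ne'; rfl
  | succ n ih =>
    obtain ⟨k, rfl⟩ := Nat.exists_eq_add_one_of_ne_zero (Nat.ne_zero_of_lt h)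
    rw [gaussBinom_succ_succ, ih (by omega), ih (by omega)]
    simp

theorem gaussBinom_self (n : ℕ) : gaussBinom q n n = 1 := by
  induction n with
  | zero => rfl
  | succ n ih => rw [gaussBinom_succ_succ, ih, gaussBinom_of_lt q n.lt_succ_self]; simp

theorem map_gaussBinom {B : Type*} [CommRing B] (f : A →+* B) (n k : ℕ) :
    f (gaussBinom q n k) = gaussBinom (f q) n k := by
  induction n generalizing k with
  | zero => cases k <;> simp [gaussBinom]
  | succ n ih => cases k <;> simp [gaussBinom, ih]

theorem gaussBinom_mul_qPochhammer (a b : ℕ) :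
    gaussBinom q (a + b) a * qPochhammer q a * qPochhammer q b = qPochhammer q (a + b) := by
  induction h : a + b generalizing a b with
  | zero =>
    obtain ⟨rfl, rfl⟩ : a = 0 ∧ b = 0 := by omega
    simp [qPochhammer, gaussBinom]
  | succ n ih =>
    rcases a with _ | a
    · obtain rfl : b = n + 1 := by omega
      simp [gaussBinom_zero_right, qPochhammer]
    rcases b with _ | b
    · obtain rfl : a = n := by omega
      simp [gaussBinom_self, qPochhammer]
    have h₁ := ih a (b + 1) (by omega)
    have h₂ := ih (a + 1) b (by omega)
    obtain rfl : n = a + b + 1 := by omega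
    simp only [gaussBinom_succ_succ, qPochhammer, prod_range_succ] at h₁ h₂ ⊢
    linear_combination (1 - q ^ (a + 1)) * h₁ + q ^ (a + 1) * (1 - q ^ (b + 1)) * h₂

/-- The `q`-binomial theorem. -/
theorem prod_add_mul_pow (x y : A) (n : ℕ) :
    ∏ k ∈ range n, (y + x * q ^ k) =
      ∑ k ∈ range (n + 1), q ^ k.choose 2 * gaussBinom q n k * x ^ k * y ^ (n - k) := by
  induction n generalizing x with
  | zero => simp [gaussBinom]
  | succ n ih =>
    have hshift : ∀ k, y + x * q ^ (k + 1) = y + x * q * q ^ k := fun k ↦ by ring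
    rw [prod_range_succ', prod_congr rfl fun k _ ↦ hshift k, ih, sum_range_succ' _ (n + 1)]
    have hsplit : ∀ k ∈ range (n + 1),
        q ^ (k + 1).choose 2 * gaussBinom q (n + 1) (k + 1) * x ^ (k + 1) * y ^ (n + 1 - (k + 1)) =
          x * (q ^ k.choose 2 * gaussBinom q n k * (x * q) ^ k * y ^ (n - k)) +
          q ^ (k + 1).choose 2 * gaussBinom q n (k + 1) * (x * q) ^ (k + 1) * y ^ (n - k) := by
      intro k _
      rw [gaussBinom_succ_succ, Nat.choose_succ_succ' k 1, Nat.choose_one_right,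
        Nat.add_sub_add_right]
      ring
    rw [sum_congr rfl hsplit, sum_add_distrib, ← mul_sum]
    have htail : ∑ k ∈ range (n + 1),
          q ^ (k + 1).choose 2 * gaussBinom q n (k + 1) * (x * q) ^ (k + 1) * y ^ (n - k) +
          y ^ (n + 1) =
        y * ∑ k ∈ range (n + 1), q ^ k.choose 2 * gaussBinom q n k * (x * q) ^ k * y ^ (n - k) := by
      rw [sum_range_succ, gaussBinom_of_lt q n.lt_succ_self, sum_range_succ' _ n, mul_add, mul_sum]
      have : ∀ k ∈ range n,
          q ^ (k + 1).choose 2 * gaussBinom q n (k + 1) * (x * q) ^ (k + 1) * y ^ (n - k) =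
          y * (q ^ (k + 1).choose 2 * gaussBinom q n (k + 1) * (x * q) ^ (k + 1) *
            y ^ (n - (k + 1))) := by
        intro k hk
        rw [mem_range] at hk
        rw [show n - k = n - (k + 1) + 1 by omega]
        ring
      rw [sum_congr rfl this]
      simp [gaussBinom_zero_right, pow_succ']
    simp only [gaussBinom_zero_right, Nat.choose_zero_succ, pow_zero, Nat.sub_zero, mul_one,
      one_mul] at htail ⊢
    linear_combination -htail

end GaussBinom

section FiniteJacobi

open Polynomial

/-- The exponent `(k - n) * (k - n - 1) / 2`, written without negative numbers. -/
def jacobiExponent (n k : ℕ) : ℕ := (k - n).choose 2 + (n + 1 - k).choose 2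

theorem two_mul_jacobiExponent (n k : ℕ) :
    2 * (jacobiExponent n k : ℤ) = (k - n) * (k - n - 1) := by
  have key (m : ℕ) : 2 * ((m + 1).choose 2 : ℤ) = (m + 1) * m := by
    rw [Nat.choose_two_right, Nat.add_sub_cancel]
    exact_mod_cast Nat.mul_div_cancel' (Nat.even_mul_pred_self (m + 1)).two_dvd
  rcases le_or_gt k n with h | h
  · obtain ⟨d, rfl⟩ := Nat.exists_eq_add_of_le h
    have : jacobiExponent (k + d) k = (d + 1).choose 2 := by
      simp [jacobiExponent, show k + d + 1 - k = d + 1 by omega]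
    rw [this, key]
    push_cast
    ring
  · obtain ⟨d, rfl⟩ := Nat.exists_eq_add_of_lt h
    have : jacobiExponent n (n + d + 1) = (d + 1).choose 2 := by
      simp [jacobiExponent, show n + d + 1 - n = d + 1 by omega]
    rw [this, key]
    push_cast
    ring

theorem choose_two_add_eq_jacobiExponent {n k : ℕ} (hk : k ≤ 2 * n + 1) :
    k.choose 2 + n * (2 * n + 1 - k) = (n + 1).choose 2 + n * n + jacobiExponent n k := by
  have h := two_mul_jacobiExponent n k
  have h₀ := two_mul_jacobiExponent 0 k
  have h₁ := two_mul_jacobiExponent 0 (n + 1)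
  have e (m : ℕ) : jacobiExponent 0 m = m.choose 2 := by
    rcases m with _ | m <;> simp [jacobiExponent]
  rw [e] at h₀ h₁
  zify [hk]
  push_cast at *
  linarith

variable {A : Type*} [CommRing A] (q : A)

/-- The product side of the finite form of Jacobi's triple product identity. -/
theorem prod_pow_sub_mul_X (n : ℕ) :
    ∏ k ∈ range (2 * n + 1), (C (q ^ n) - C (q ^ k) * X) =
      ∑ k ∈ range (2 * n + 2), C (q ^ ((n + 1).choose 2 + n * n) *
        ((-1) ^ k * q ^ jacobiExponent n k * gaussBinom q (2 * n + 1) k)) * X ^ k := by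
  have h := prod_add_mul_pow (C q) (-X) (C (q ^ n)) (2 * n + 1)
  rw [prod_congr rfl fun k _ ↦ show C (q ^ n) - C (q ^ k) * X = C (q ^ n) + -X * C q ^ k by
    simp only [C_pow]; ring, h]
  refine sum_congr rfl fun k hk ↦ ?_
  have he := choose_two_add_eq_jacobiExponent (n := n) (k := k) (by grind)
  have hq : (C q : A[X]) ^ k.choose 2 * C q ^ (n * (2 * n + 1 - k)) =
      C q ^ ((n + 1).choose 2 + n * n) * C q ^ jacobiExponent n k := by
    rw [← pow_add, ← pow_add, he]
  rw [← map_gaussBinom, neg_pow]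
  simp only [C_pow, C_mul, C_neg, C_1, ← pow_mul]
  linear_combination (C (gaussBinom q (2 * n + 1) k) * (-1) ^ k * X ^ k) * hq

theorem prod_pow_sub_pow (n : ℕ) :
    ∏ k ∈ range n, (q ^ n - q ^ k) = (-1) ^ n * q ^ n.choose 2 * qPochhammer q n := by
  have hterm : ∀ k ∈ range n, q ^ n - q ^ k = -1 * q ^ k * (1 - q ^ (n - 1 - k + 1)) := by
    intro k hk
    have hn : n = k + (n - 1 - k + 1) := by grind
    nth_rewrite 1 [hn]
    ring
  rw [prod_congr rfl hterm, prod_mul_distrib, prod_mul_distrib, prod_const, card_range,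
    prod_pow_eq_pow_sum, sum_range_id, ← Nat.choose_two_right,
    prod_range_reflect (fun i ↦ 1 - q ^ (i + 1)), qPochhammer]

theorem prod_pow_sub_pow_add (n : ℕ) :
    ∏ k ∈ range n, (q ^ n - q ^ (n + 1 + k)) = q ^ (n * n) * qPochhammer q n := by
  rw [prod_congr rfl fun k _ ↦ show q ^ n - q ^ (n + 1 + k) = q ^ n * (1 - q ^ (k + 1)) by ring,
    prod_mul_distrib, qPochhammer, prod_const, card_range, pow_mul]

/-- A finite form of Jacobi's identity for the cube of the Euler function. -/
theorem pow_mul_sum_jacobi (n : ℕ) :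
    q ^ ((n + 1).choose 2 + n * n) * ∑ k ∈ range (2 * n + 2),
      (-1) ^ k * (2 * k - 2 * n - 1) * q ^ jacobiExponent n k * gaussBinom q (2 * n + 1) k =
    q ^ ((n + 1).choose 2 + n * n) * (-2 * (-1) ^ n * qPochhammer q n ^ 2) := by
  have h := prod_pow_sub_mul_X q n
  have hfactor : ∏ k ∈ range (2 * n + 1), (C (q ^ n) - C (q ^ k) * X) =
      (1 - X) * (C (q ^ n) * (∏ k ∈ range n, (C (q ^ n) - C (q ^ k) * X)) *
        ∏ k ∈ range n, (C (q ^ n) - C (q ^ (n + 1 + k)) * X)) := by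
    rw [show 2 * n + 1 = n + 1 + n by ring, prod_range_add, prod_range_succ]
    ring
  rw [hfactor] at h
  have h₀ := congrArg (eval 1) h
  have h₁ := congrArg (fun p ↦ eval 1 (derivative p)) h
  simp only [derivative_mul, derivative_sub, derivative_one, derivative_X, eval_add, eval_mul,
    eval_sub, eval_one, eval_X, sub_self, zero_mul, zero_sub, add_zero, eval_prod, eval_C, mul_one,
    prod_pow_sub_pow, prod_pow_sub_pow_add, derivative_sum, eval_finsetSum, derivative_C,
    derivative_X_pow, eval_pow, one_pow, zero_add, eval_neg] at h₀ h₁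
  have hchoose : (n + 1).choose 2 = n + n.choose 2 := by
    rw [Nat.choose_succ_succ' n 1, Nat.choose_one_right]
  have hsum : q ^ ((n + 1).choose 2 + n * n) * ∑ k ∈ range (2 * n + 2),
      (-1) ^ k * (2 * k - 2 * n - 1) * q ^ jacobiExponent n k * gaussBinom q (2 * n + 1) k =
      2 * (∑ k ∈ range (2 * n + 2), q ^ ((n + 1).choose 2 + n * n) *
        ((-1) ^ k * q ^ jacobiExponent n k * gaussBinom q (2 * n + 1) k) * (k : A)) -
      (2 * n + 1) * ∑ k ∈ range (2 * n + 2), q ^ ((n + 1).choose 2 + n * n) *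
        ((-1) ^ k * q ^ jacobiExponent n k * gaussBinom q (2 * n + 1) k) := by
    simp only [mul_sum, ← sum_sub_distrib]
    refine sum_congr rfl fun k _ ↦ by ring
  rw [hsum, ← h₀, ← h₁, hchoose]
  ring

end FiniteJacobi

section PowerSeriesJacobi

open PowerSeries
open scoped PowerSeries.WithPiTopology

variable (R : Type*) [CommRing R]

theorem X_pow_dvd_pentagonalSeries_sub {N n : ℕ} (h : N ≤ n) :
    (X : R⟦X⟧) ^ (N + 1) ∣ pentagonalSeries R - qPochhammer X n := by
  rw [X_pow_dvd_iff]
  intro m hm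
  obtain ⟨s, hs⟩ := Filter.eventually_atTop.mp (coeff_prod_one_sub_X_pow_eventually_eq R m)
  have hstable : ∀ k, coeff m (qPochhammer (X : R⟦X⟧) (n + k)) = coeff m (qPochhammer X n) := by
    intro k
    induction k with
    | zero => rfl
    | succ k ih =>
      rw [← ih, ← add_assoc, qPochhammer, prod_range_succ, mul_sub, mul_one, map_sub,
        coeff_mul_X_pow', if_neg (by omega), sub_zero, qPochhammer]
  obtain ⟨k, hk⟩ := s.bddAbove
  have hsub : s ⊆ range (n + (k + 1)) := fun i hi ↦ by
    have := hk hi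
    grind
  rw [map_sub, ← hs _ hsub, ← hstable (k + 1), qPochhammer, sub_self]

theorem isUnit_pentagonalSeries : IsUnit (pentagonalSeries R) := by
  rw [isUnit_iff_constantCoeff, ← coeff_zero_eq_constantCoeff_apply]
  have h := coeff_pentagonalSeries_pentagonal R 0
  simp only [pentagonal_def, zero_mul, Int.zero_ediv, Int.toNat_zero] at h
  rw [h]
  simp

theorem X_pow_dvd_pentagonalSeries_mul_gaussBinom {N a b : ℕ} (ha : N ≤ a) (hb : N ≤ b) :
    (X : R⟦X⟧) ^ (N + 1) ∣ pentagonalSeries R * gaussBinom X (a + b) a - 1 := by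
  obtain ⟨P, hP⟩ := (isUnit_pentagonalSeries R).exists_left_inv
  obtain ⟨u, hu⟩ := X_pow_dvd_pentagonalSeries_sub R ha
  obtain ⟨v, hv⟩ := X_pow_dvd_pentagonalSeries_sub R hb
  obtain ⟨w, hw⟩ := X_pow_dvd_pentagonalSeries_sub R (ha.trans (Nat.le_add_right a b))
  have h := gaussBinom_mul_qPochhammer (X : R⟦X⟧) a b
  set E := pentagonalSeries R
  set g := gaussBinom (X : R⟦X⟧) (a + b) a
  set c := qPochhammer (X : R⟦X⟧) (a + b)
  refine ⟨P * (g * (E * v + qPochhammer X b * u) - w), ?_⟩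
  linear_combination (P * g * qPochhammer X b) * hu + (P * g * E) * hv - P * hw + P * h +
    (1 - E * g) * hP

/-- Jacobi's identity for the cube of the Euler function, truncated at degree `n`. -/
theorem coeff_two_mul_pentagonalSeries_pow_three {m n : ℕ} (h : m < n) :
    coeff m (2 * pentagonalSeries R ^ 3) = ∑ k ∈ range (2 * n + 2),
      if m = jacobiExponent n k then (-1) ^ (n + k + 1) * (2 * k - 2 * n - 1 : R) else 0 := by
  set E := pentagonalSeries R
  have hfin := PowerSeries.X_pow_mul_cancel (pow_mul_sum_jacobi (X : R⟦X⟧) n)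
  have hdvd : (X : R⟦X⟧) ^ n ∣ 2 * E ^ 3 - ∑ k ∈ range (2 * n + 2),
      (-1) ^ (n + k + 1) * (2 * k - 2 * n - 1 : R⟦X⟧) * X ^ jacobiExponent n k := by
    have hsum : (X : R⟦X⟧) ^ n ∣ ∑ k ∈ range (2 * n + 2),
        (-1) ^ (n + k + 1) * (2 * k - 2 * n - 1 : R⟦X⟧) * (X ^ jacobiExponent n k *
          (E * gaussBinom X (2 * n + 1) k - 1)) := by
      refine dvd_sum fun k hk ↦ Dvd.dvd.mul_left ?_ _
      have hk' : k ≤ 2 * n + 1 := by grind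
      have hg := X_pow_dvd_pentagonalSeries_mul_gaussBinom R (N := min k (2 * n + 1 - k))
        (a := k) (b := 2 * n + 1 - k) (min_le_left _ _) (min_le_right _ _)
      rw [Nat.add_sub_cancel' hk'] at hg
      refine (pow_dvd_pow (X : R⟦X⟧) ?_).trans (by rw [pow_add]; exact mul_dvd_mul_left _ hg)
      have hj := two_mul_jacobiExponent n k
      zify
      rcases le_or_gt k n with hkn | hkn
      · rw [min_eq_left (by omega)]
        obtain ⟨d, rfl⟩ := Nat.exists_eq_add_of_le hkn
        push_cast at hj ⊢
        have : (0 : ℤ) ≤ d * (d - 1) := by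
          rcases d with _ | d
          · simp
          · push_cast
            nlinarith
        nlinarith
      · rw [min_eq_right (by omega)]
        obtain ⟨d, rfl⟩ := Nat.exists_eq_add_of_lt hkn
        have : (0 : ℤ) ≤ d * (d - 1) := by
          rcases d with _ | d
          · simp
          · push_cast
            nlinarith
        rw [show 2 * n + 1 - (n + d + 1) = n - d by omega]
        push_cast [show d ≤ n by omega] at hj ⊢
        nlinarith
    obtain ⟨u, hu⟩ := X_pow_dvd_pentagonalSeries_sub R (le_refl n)
    have hE : (X : R⟦X⟧) ^ n ∣ 2 * E ^ 3 - 2 * E * qPochhammer X n ^ 2 :=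
      ⟨2 * E * (E + qPochhammer X n) * X * u,
        by linear_combination 2 * E * (E + qPochhammer X n) * hu⟩
    have hfin' : 2 * E * qPochhammer X n ^ 2 = ∑ k ∈ range (2 * n + 2),
        (-1) ^ (n + k + 1) * (2 * k - 2 * n - 1 : R⟦X⟧) * (X ^ jacobiExponent n k *
          (E * gaussBinom X (2 * n + 1) k)) := by
      have hsign : ((-1) ^ n * (-1) ^ n : R⟦X⟧) = 1 := by rw [← mul_pow]; simp
      calc _ = -(-1) ^ n * E * (-2 * (-1) ^ n * qPochhammer X n ^ 2) := by
            linear_combination (-2 * E * qPochhammer X n ^ 2) * hsign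
        _ = _ := by
            rw [← hfin, mul_sum]
            exact sum_congr rfl fun k _ ↦ by ring
    convert dvd_add hE hsum using 1
    rw [hfin']
    simp only [mul_sub, mul_one, sum_sub_distrib]
    ring
  have := X_pow_dvd_iff.mp hdvd m h
  rw [map_sub, sub_eq_zero] at this
  rw [this, map_sum]
  refine sum_congr rfl fun k _ ↦ ?_
  have hC : ((-1) ^ (n + k + 1) * (2 * k - 2 * n - 1) : R⟦X⟧) =
      C ((-1) ^ (n + k + 1) * (2 * k - 2 * n - 1 : R)) := by
    simp [show C (2 : R) = 2 from map_ofNat C 2]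
  rw [hC, coeff_C_mul, coeff_X_pow]
  simp

theorem mk_card_partition_mul_pentagonalSeries :
    (PowerSeries.mk fun n ↦ (Fintype.card (Nat.Partition n) : R)) * pentagonalSeries R = 1 := by
  let _ : TopologicalSpace R := ⊥
  have _ : DiscreteTopology R := ⟨rfl⟩
  have hP := Nat.Partition.hasProd_powerSeriesMk_card_restricted R fun _ ↦ True
  have h := hP.mul (WithPiTopology.hasProd_one_sub_X_pow R)
  simp only [if_true, pow_mul] at h
  simp_rw [WithPiTopology.tsum_pow_mul_one_sub_of_constantCoeff_eq_zero
    (show constantCoeff ((X : R⟦X⟧) ^ (_ + 1)) = 0 by simp)] at h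
  have := h.unique hasProd_one
  simpa [Nat.Partition.restricted, Finset.card_univ] using this

end PowerSeriesJacobi

section ResiduePart

open PowerSeries

variable {R : Type*} [CommRing R]

/-- The part of a power series supported on exponents congruent to `r` modulo `m`. -/
noncomputable def residuePart (m r : ℕ) (f : R⟦X⟧) : R⟦X⟧ :=
  PowerSeries.mk fun n ↦ if n % m = r then coeff n f else 0

theorem residuePart_eq_zero {m r : ℕ} {f : R⟦X⟧} (h : ∀ n, n % m = r → coeff n f = 0) :
    residuePart m r f = 0 := by
  ext n
  simpa [residuePart] using h n

theorem residuePart_mul {m r : ℕ} (hr : r < m) (f g : R⟦X⟧) :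
    residuePart m r (f * g) =
      ∑ s ∈ range m, residuePart m s f * residuePart m ((r + (m - s)) % m) g := by
  ext n
  simp only [residuePart, coeff_mk, coeff_mul, map_sum]
  rw [sum_comm]
  simp only [ite_mul, zero_mul, sum_ite_eq, mem_range, Nat.mod_lt _ (show m > 0 by omega), if_true]
  have key : ∀ p ∈ antidiagonal n, p.2 % m = (r + (m - p.1 % m)) % m ↔ n % m = r := by
    intro p hp
    rw [← mem_antidiagonal.mp hp]
    have hlt : p.1 % m < m := Nat.mod_lt _ (by omega)
    have hmod : p.1 % m ≡ p.1 [MOD m] := Nat.mod_modEq _ _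
    have hr' : (p.1 + p.2) % m = r ↔ p.1 + p.2 ≡ r [MOD m] := by
      rw [Nat.ModEq, Nat.mod_eq_of_lt hr]
    have hsub : r + (m - p.1 % m) + p.1 % m ≡ r [MOD m] := by
      rw [show r + (m - p.1 % m) + p.1 % m = r + m by omega]
      simp [Nat.ModEq]
    rw [hr']
    change p.2 ≡ _ [MOD m] ↔ _
    constructor
    · intro h
      rw [add_comm]
      exact (h.add hmod.symm).trans hsub
    · intro h
      refine Nat.ModEq.add_right_cancel' (p.1 % m) (Nat.ModEq.trans ?_ hsub.symm)
      exact ((hmod.add_left p.2).trans (by rw [add_comm])).trans h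
  split_ifs with hn
  · exact sum_congr rfl fun p hp ↦ by rw [if_pos ((key p hp).mpr hn)]
  · exact (sum_eq_zero fun p hp ↦ by rw [if_neg (mt (key p hp).mp hn), mul_zero]).symm

theorem residuePart_mul_of_support {m r : ℕ} (f : R⟦X⟧) {g : R⟦X⟧}
    (hg : ∀ n, ¬ m ∣ n → coeff n g = 0) :
    residuePart m r (f * g) = residuePart m r f * g := by
  ext n
  simp only [residuePart, coeff_mk, coeff_mul]
  have key : ∀ p ∈ antidiagonal n, m ∣ p.2 → p.1 % m = n % m := by
    rintro p hp ⟨c, hc⟩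
    rw [← mem_antidiagonal.mp hp, hc, Nat.add_mul_mod_self_left]
  split_ifs with hn
  · refine sum_congr rfl fun p hp ↦ ?_
    by_cases h : m ∣ p.2
    · rw [if_pos ((key p hp h).trans hn)]
    · rw [hg _ h, mul_zero, mul_zero]
  · refine (sum_eq_zero fun p hp ↦ ?_).symm
    by_cases h : m ∣ p.2
    · rw [if_neg fun h' ↦ hn ((key p hp h).symm.trans h'), zero_mul]
    · rw [hg _ h, mul_zero]

theorem coeff_pow_char_eq_zero {p : ℕ} [Fact p.Prime] (f : (ZMod p)⟦X⟧) {n : ℕ} (hn : ¬ p ∣ n) :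
    coeff n (f ^ p) = 0 := by
  have h : coeff (n - 1) (derivative (ZMod p) (f ^ p)) = 0 := by
    have hp : (p : (ZMod p)⟦X⟧) = 0 := by
      rw [← map_natCast (C (R := ZMod p)), CharP.cast_eq_zero, map_zero]
    simp [Derivation.leibniz_pow, hp]
  have hn0 : n - 1 + 1 = n := Nat.sub_add_cancel (Nat.pos_of_ne_zero (by rintro rfl; simp at hn))
  rw [coeff_derivative, hn0] at h
  refine (mul_eq_zero.mp h).resolve_right fun h' ↦ hn ?_
  rw [← CharP.cast_eq_zero_iff (ZMod p), ← h']
  exact_mod_cast congrArg _ hn0.symm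

end ResiduePart

section ModEleven

open PowerSeries

theorem residuePart_pentagonalSeries {r : ℕ} (hr : r ∈ ({3, 6, 8, 9, 10} : Finset ℕ)) :
    residuePart 11 r (pentagonalSeries (ZMod 11)) = 0 := by
  refine residuePart_eq_zero fun n hn ↦ coeff_pentagonalSeries_eq_zero _ ?_
  rintro ⟨k, rfl⟩
  have h := congrArg (Int.cast : ℤ → ZMod 11) (two_mul_natCast_pentagonal k)
  have hcast : ((pentagonal k : ℕ) : ZMod 11) = (r : ZMod 11) := by
    rw [← hn, ZMod.natCast_mod]
  push_cast [hcast] at h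
  clear hn hcast
  generalize (k : ZMod 11) = x at h
  revert r x
  decide

theorem residuePart_pentagonalSeries_cube {r : ℕ} (hr : r ∈ ({2, 4, 5, 7, 8, 9} : Finset ℕ)) :
    residuePart 11 r (pentagonalSeries (ZMod 11) ^ 3) = 0 := by
  refine residuePart_eq_zero fun m hm ↦ ?_
  have h := coeff_two_mul_pentagonalSeries_pow_three (ZMod 11) m.lt_succ_self
  rw [sum_eq_zero] at h
  · have htwo : (2 : ZMod 11) ≠ 0 := by decide
    have : Fact (Nat.Prime 11) := ⟨by norm_num⟩
    rw [show (2 : (ZMod 11)⟦X⟧) = C 2 from (map_ofNat C 2).symm, coeff_C_mul] at h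
    exact (mul_eq_zero.mp h).resolve_left htwo
  intro k _
  split_ifs with hmk
  swap
  · rfl
  have hj := congrArg (Int.cast : ℤ → ZMod 11) (two_mul_jacobiExponent (m + 1) k)
  rw [← hmk] at hj
  have hcast : (m : ZMod 11) = (r : ZMod 11) := by rw [← hm, ZMod.natCast_mod]
  push_cast [hcast] at hj
  have hzero : (2 * k - 2 * (m + 1 : ℕ) - 1 : ZMod 11) = 0 := by
    push_cast [hcast]
    clear hm h hcast hmk
    generalize (k : ZMod 11) = x at hj ⊢
    revert r x
    decide
  rw [hzero, mul_zero]

/-- If `J = ∑ Jᵢ` is graded by exponents modulo `11` with `Jᵢ = 0` unless `i ∈ {0, 1, 3, 6, 10}`,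
and the parts of `J ^ 4` of degrees `3`, `6`, `8`, `9`, `10` vanish, then so does the part of
`J ^ 7` of degree `6`. -/
theorem residuePart_six_pow_seven {J : (ZMod 11)⟦X⟧}
    (hJ : ∀ r ∈ ({2, 4, 5, 7, 8, 9} : Finset ℕ), residuePart 11 r J = 0)
    (hJ4 : ∀ r ∈ ({3, 6, 8, 9, 10} : Finset ℕ), residuePart 11 r (J ^ 4) = 0) :
    residuePart 11 6 (J ^ 7) = 0 := by
  simp only [mem_insert, mem_singleton, forall_eq_or_imp, forall_eq] at hJ hJ4
  obtain ⟨e2, e4, e5, e7, e8, e9⟩ := hJ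
  obtain ⟨h3, h6, h8, h9, h10⟩ := hJ4
  have h11 : (11 : (ZMod 11)⟦X⟧) = 0 := by
    rw [show (11 : (ZMod 11)⟦X⟧) = C 11 from (map_ofNat C 11).symm,
      show (11 : ZMod 11) = 0 from rfl, map_zero]
  rw [show J ^ 4 = J * J * (J * J) by ring] at h3 h6 h8 h9 h10
  rw [show J ^ 7 = J * J * (J * J) * (J * J * J) by ring]
  simp only [residuePart_mul (show 0 < 11 by norm_num), residuePart_mul (show 1 < 11 by norm_num),
    residuePart_mul (show 2 < 11 by norm_num), residuePart_mul (show 3 < 11 by norm_num),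
    residuePart_mul (show 4 < 11 by norm_num), residuePart_mul (show 5 < 11 by norm_num),
    residuePart_mul (show 6 < 11 by norm_num), residuePart_mul (show 7 < 11 by norm_num),
    residuePart_mul (show 8 < 11 by norm_num), residuePart_mul (show 9 < 11 by norm_num),
    residuePart_mul (show 10 < 11 by norm_num), sum_range_succ, range_zero, sum_empty,
    Nat.reduceSub, Nat.reduceAdd, Nat.reduceMod, e2, e4, e5, e7, e8, e9, zero_add, add_zero,
    mul_zero, zero_mul] at h3 h6 h8 h9 h10 ⊢
  generalize residuePart 11 0 J = J0 at *
  generalize residuePart 11 1 J = J1 at *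
  generalize residuePart 11 3 J = J3 at *
  generalize residuePart 11 6 J = J6 at *
  generalize residuePart 11 10 J = J10 at *
  clear e2 e4 e5 e7 e8 e9
  linear_combination (4 * J0^2 * J3 - J1^3 - J1 * J3 * J10) * h3 + (-J0^3 - J0 * J1 * J10 + 4 *
      J6^2 * J10) * h6 + (-J0 * J3 * J6 + 4 * J0 * J10^2 - J3^3) * h8 + (4 * J1^2 * J6 - J3 * J6 *
      J10 - J10^3) * h9 + (-J0 * J1 * J6 + 4 * J1 * J3^2 - J6^3) * h10 + (22 * J0 * J1^4 * J3 *
      J10 + J1^2 * J3^5 + J6^5 * J10^2 + 12 * J0^3 * J6^3 * J10 + 54 * J0 * J1^2 * J3^2 * J10^2 +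
      12 * J1 * J3^3 * J6^3 + 22 * J1 * J3 * J6 * J10^4 + 22 * J0 * J1 * J3 * J6^4 + 54 * J0^2 *
      J1^2 * J3 * J6^2 + 22 * J0^4 * J1 * J6 * J10 + J1 * J10^6 + J0^2 * J10^5 + 12 * J0 * J3^3 *
      J10^3 + 54 * J0^2 * J1^2 * J6 * J10^2 + 30 * J0 * J1 * J6^3 * J10^2 + J3 * J6^6 + 30 * J0 *
      J1^2 * J3^3 * J6 + 22 * J0 * J3^4 * J6 * J10 + J1^5 * J6^2 + J0^6 * J6 + J3^6 * J10 + 12 *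
      J0^3 * J1^3 * J3 + J0 * J1^6 + 30 * J1^3 * J3 * J6^2 * J10 + 30 * J0^2 * J3 * J6 * J10^3 +
      12 * J1^3 * J6 * J10^3 + 54 * J0^2 * J3^2 * J6^2 * J10 + 54 * J1 * J3^2 * J6^2 * J10^2 + 30
      * J0^3 * J1 * J3^2 * J10 + J0^5 * J3^2) * h11

end ModEleven

/-- Ramanujan's congruence: for all `n ≥ 0`, the number of partitions of `11n+6`
is divisible by `11`. -/
theorem partition_11n6_mod11 (n : ℕ) : 11 ∣ Fintype.card (Nat.Partition (11 * n + 6)) := by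
  have : Fact (Nat.Prime 11) := ⟨by norm_num⟩
  have hP := mk_card_partition_mul_pentagonalSeries (ZMod 11)
  set P : PowerSeries (ZMod 11) :=
    PowerSeries.mk fun n ↦ (Fintype.card (Nat.Partition n) : ZMod 11) with hPdef
  set E := PowerSeries.pentagonalSeries (ZMod 11)
  have hE7 : residuePart 11 6 ((E ^ 3) ^ 7) = 0 := by
    refine residuePart_six_pow_seven (fun r hr ↦ residuePart_pentagonalSeries_cube hr)
      fun r hr ↦ ?_
    rw [show (E ^ 3) ^ 4 = E * E ^ 11 by ring,
      residuePart_mul_of_support _ fun _ ↦ coeff_pow_char_eq_zero E,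
      residuePart_pentagonalSeries hr, zero_mul]
  have hPE : P = (E ^ 3) ^ 7 * (P ^ 2) ^ 11 := by
    calc P = P * (P * E) ^ 21 := by rw [hP, one_pow, mul_one]
      _ = _ := by ring
  have hP6 : residuePart 11 6 P = 0 := by
    rw [hPE, residuePart_mul_of_support _ fun _ ↦ coeff_pow_char_eq_zero (P ^ 2), hE7, zero_mul]
  have h := congrArg (PowerSeries.coeff (11 * n + 6)) hP6
  rw [residuePart, PowerSeries.coeff_mk, if_pos (by omega), hPdef, PowerSeries.coeff_mk,
    map_zero] at h
  exact (CharP.cast_eq_zero_iff (ZMod 11) 11 _).mp h
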